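/- (Duality transfer) Let 1 < p ≤ 2 with 1/p + 1/q = 1. If for all m×m complex matrices x_1,…,x_n one has ‖∑ x_i‖_p^q + ∑_{i<j} ‖x_i − x_j‖_p^q ≤ n·(∑ ‖x_i‖_p^p)^(q/p), then for all m×m complex matrices φ_1,…,φ_n one has n·(∑ ‖φ_i‖_q^q)^(p/q) ≤ ‖∑ φ_i‖_q^p + ∑_{i<j} ‖φ_i − φ_j‖_q^p. -/

import Mathlib

open scoped ComplexOrder

/-- The Schatten `p`-(quasi)norm of a square complex matrix:
`‖X‖_p = (tr |X|^p)^(1/p)`, computed as `(∑ i, λ_i(Xᴴ * X) ^ (p/2)) ^ (1/p)`,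
where `λ_i(Xᴴ * X)` are the (nonnegative) eigenvalues of `Xᴴ * X`, whose square
roots are the singular values of `X`. -/
noncomputable def schattenNorm {m : Type*} [Fintype m] [DecidableEq m]
    (p : ℝ) (X : Matrix m m ℂ) : ℝ :=
  (∑ i, ((Matrix.posSemidef_conjTranspose_mul_self X).1.eigenvalues i ^ (p / 2))) ^ (1 / p)


open Matrix

section Schatten

variable {m : Type*} [Fintype m] [DecidableEq m]

/-- Singular value decomposition of a square complex matrix. -/
theorem exists_singularValueDecomposition (X : Matrix m m ℂ) :
    ∃ U V : Matrix m m ℂ, ∃ d : m → ℝ, U ∈ unitaryGroup m ℂ ∧ V ∈ unitaryGroup m ℂ ∧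
      (∀ i, 0 ≤ d i) ∧ X = U * diagonal (fun i => (d i : ℂ)) * Vᴴ := by
  have hX := posSemidef_conjTranspose_mul_self X
  set V : Matrix m m ℂ := (hX.1.eigenvectorUnitary : Matrix m m ℂ)
  have hV : V ∈ unitaryGroup m ℂ := hX.1.eigenvectorUnitary.2
  have hVV : V * Vᴴ = 1 := mem_unitaryGroup_iff.mp hV
  have hVV' : Vᴴ * V = 1 := mem_unitaryGroup_iff'.mp hV
  set e := hX.1.eigenvalues
  have hspec : Xᴴ * X = V * diagonal (fun i => (e i : ℂ)) * Vᴴ := by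
    have := hX.1.spectral_theorem
    rw [Unitary.conjStarAlgAut_apply] at this
    exact this
  have he : ∀ i, 0 ≤ e i := hX.eigenvalues_nonneg
  set W := X * V with hW
  have hWW : Wᴴ * W = diagonal (fun i => (e i : ℂ)) := by
    calc Wᴴ * W = Vᴴ * (Xᴴ * X) * V := by simp [hW, Matrix.mul_assoc]
      _ = (Vᴴ * V) * diagonal (fun i => (e i : ℂ)) * (Vᴴ * V) := by
        rw [hspec]; simp only [Matrix.mul_assoc]
      _ = _ := by simp [hVV']
  let w : m → EuclideanSpace ℂ m := fun i => WithLp.toLp 2 (fun k => W k i)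
  have hw : ∀ i j, inner ℂ (w i) (w j) = if i = j then (e i : ℂ) else 0 := by
    intro i j
    rw [← diagonal_apply (d := fun i => (e i : ℂ)), ← hWW, mul_apply]
    simp [w, PiLp.inner_apply, mul_comm]
  obtain ⟨b, hb⟩ := Orthonormal.exists_orthonormalBasis_extension_of_card_eq (𝕜 := ℂ)
    (v := fun i => ((√(e i))⁻¹ : ℂ) • w i) (s := {i | e i ≠ 0})
    (finrank_euclideanSpace (𝕜 := ℂ) (ι := m)) (by
      rw [orthonormal_iff_ite]
      rintro ⟨i, hi⟩ ⟨j, hj⟩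
      have hi' : (√(e i) : ℂ) ≠ 0 := by
        exact_mod_cast (Real.sqrt_pos.mpr (lt_of_le_of_ne (he i) (Ne.symm hi))).ne'
      simp only [Set.domRestrict_apply, inner_smul_left, inner_smul_right, hw, Subtype.mk.injEq]
      split_ifs with hij
      · subst hij
        have h2 : (e i : ℂ) = √(e i) * √(e i) := by
          exact_mod_cast (Real.mul_self_sqrt (he i)).symm
        simp only [map_inv₀, Complex.conj_ofReal]
        rw [h2]
        field_simp
      · simp)
  have hbW : ∀ k i, W k i = b i k * √(e i) := by
    intro k i
    by_cases hi : e i = 0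
    · have : w i = 0 := by
        rw [← inner_self_eq_zero (𝕜 := ℂ), hw]; simp [hi]
      have := congrArg (fun v : EuclideanSpace ℂ m => v k) this
      simpa [w, hi] using this
    · have hi' : (√(e i) : ℂ) ≠ 0 := by
        exact_mod_cast (Real.sqrt_pos.mpr (lt_of_le_of_ne (he i) (Ne.symm hi))).ne'
      rw [hb i hi]
      simp only [w, PiLp.smul_apply, smul_eq_mul]
      field_simp
  refine ⟨of fun k i => b i k, V, fun i => √(e i), ?_, hV, fun i => Real.sqrt_nonneg _, ?_⟩
  · rw [mem_unitaryGroup_iff']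
    ext i j
    have := orthonormal_iff_ite.mp b.orthonormal i j
    rw [PiLp.inner_apply] at this
    simpa [mul_apply, one_apply, mul_comm] using this
  · have : W = (of fun k i => b i k) * diagonal (fun i => (√(e i) : ℂ)) := by
      ext k i
      simp [mul_diagonal, hbW]
    rw [← this, hW, Matrix.mul_assoc, hVV, Matrix.mul_one]

theorem schattenNorm_unitary_mul_diagonal_mul {U V : Matrix m m ℂ} {d : m → ℝ}
    (hU : U ∈ unitaryGroup m ℂ) (hV : V ∈ unitaryGroup m ℂ) (hd : ∀ i, 0 ≤ d i) (r : ℝ) :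
    schattenNorm r (U * diagonal (fun i => (d i : ℂ)) * Vᴴ) = (∑ i, d i ^ r) ^ (1 / r) := by
  have hUU : Uᴴ * U = 1 := mem_unitaryGroup_iff'.mp hU
  have hVV : Vᴴ * V = 1 := mem_unitaryGroup_iff'.mp hV
  set X := U * diagonal (fun i => (d i : ℂ)) * Vᴴ with hXdef
  have hX := posSemidef_conjTranspose_mul_self X
  have hXX : Xᴴ * X = V * (diagonal (fun i => ((d i ^ 2 : ℝ) : ℂ)) * Vᴴ) := by
    calc Xᴴ * X = V * diagonal (fun i => (d i : ℂ)) * (Uᴴ * U) *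
          diagonal (fun i => (d i : ℂ)) * Vᴴ := by
          simp [hXdef, Matrix.mul_assoc, diagonal_conjTranspose, Pi.star_def]
      _ = _ := by
        rw [hUU, Matrix.mul_one, Matrix.mul_assoc V, diagonal_mul_diagonal, Matrix.mul_assoc]
        simp [pow_two]
  have hroots : (Xᴴ * X).charpoly.roots =
      Multiset.map (fun i => ((d i ^ 2 : ℝ) : ℂ)) Finset.univ.val := by
    rw [hXX, charpoly_mul_comm, Matrix.mul_assoc, hVV, Matrix.mul_one, charpoly_diagonal,
      ← Polynomial.roots_multiset_prod_X_sub_C (Multiset.map _ _), Multiset.map_map]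
    rfl
  rw [hX.1.roots_charpoly_eq_eigenvalues] at hroots
  have hsum := congrArg (fun s : Multiset ℂ => (s.map (fun z => z.re ^ (r / 2))).sum) hroots
  simp only [Multiset.map_map] at hsum
  unfold schattenNorm
  congr 1
  refine Eq.trans (by exact hsum) (Finset.sum_congr rfl fun i _ => ?_)
  simp only [Function.comp_apply, Complex.ofReal_re]
  rw [← Real.rpow_natCast, ← Real.rpow_mul (hd i)]
  congr 1
  push_cast
  ring

theorem sum_norm_sq_row_of_mem_unitaryGroup {U : Matrix m m ℂ} (hU : U ∈ unitaryGroup m ℂ)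
    (i : m) : ∑ j, ‖U i j‖ ^ 2 = 1 := by
  have h := congrFun (congrFun (mem_unitaryGroup_iff.mp hU) i) i
  rw [mul_apply, one_apply_eq] at h
  have h' := congrArg Complex.re h
  simpa [star_apply, Complex.mul_conj, Complex.normSq_eq_norm_sq, ← Complex.ofReal_pow] using h'

theorem sum_norm_sq_col_of_mem_unitaryGroup {U : Matrix m m ℂ} (hU : U ∈ unitaryGroup m ℂ)
    (j : m) : ∑ i, ‖U i j‖ ^ 2 = 1 := by
  simpa [star_apply] using sum_norm_sq_row_of_mem_unitaryGroup (Unitary.star_mem hU) j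

/-- Hölder's inequality for a bilinear form with doubly substochastic coefficients. -/
theorem sum_mul_le_Lp_mul_Lq_of_substochastic {ι κ : Type*} [Fintype ι] [Fintype κ] {p q : ℝ}
    (hpq : p.HolderConjugate q) {c : ι → κ → ℝ} (hc : ∀ i j, 0 ≤ c i j)
    (hrow : ∀ i, ∑ j, c i j ≤ 1) (hcol : ∀ j, ∑ i, c i j ≤ 1) {f : ι → ℝ} {g : κ → ℝ}
    (hf : ∀ i, 0 ≤ f i) (hg : ∀ j, 0 ≤ g j) :
    ∑ i, ∑ j, f i * c i j * g j ≤ (∑ i, f i ^ p) ^ (1 / p) * (∑ j, g j ^ q) ^ (1 / q) := by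
  have hq := hpq.symm.lt
  have hq0 := hpq.symm.pos
  have hcg : ∀ i, 0 ≤ ∑ j, c i j * g j :=
    fun i => Finset.sum_nonneg fun j _ => mul_nonneg (hc i j) (hg j)
  have hcgq : ∀ i, 0 ≤ ∑ j, c i j * g j ^ q :=
    fun i => Finset.sum_nonneg fun j _ => mul_nonneg (hc i j) (Real.rpow_nonneg (hg j) _)
  have hJ : ∀ i, (∑ j, c i j * g j) ^ q ≤ ∑ j, c i j * g j ^ q := by
    intro i
    have h1 := Real.inner_le_weight_mul_Lp_of_nonneg Finset.univ hq.le (c i) g (hc i) hg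
    have h2 : (∑ j, c i j) ^ (1 - q⁻¹) ≤ 1 :=
      Real.rpow_le_one (Finset.sum_nonneg fun j _ => hc i j) (hrow i)
        (sub_nonneg.mpr (inv_le_one_of_one_le₀ hq.le))
    have h3 := h1.trans (mul_le_of_le_one_left (Real.rpow_nonneg (hcgq i) _) h2)
    calc _ ≤ ((∑ j, c i j * g j ^ q) ^ q⁻¹) ^ q := Real.rpow_le_rpow (hcg i) h3 hq0.le
      _ = _ := Real.rpow_inv_rpow (hcgq i) hq0.ne'
  calc ∑ i, ∑ j, f i * c i j * g j = ∑ i, f i * ∑ j, c i j * g j := by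
        simp only [Finset.mul_sum, mul_assoc]
    _ ≤ (∑ i, f i ^ p) ^ (1 / p) * (∑ i, (∑ j, c i j * g j) ^ q) ^ (1 / q) :=
        Real.inner_le_Lp_mul_Lq_of_nonneg _ hpq (fun i _ => hf i) (fun i _ => hcg i)
    _ ≤ _ := by
        refine mul_le_mul_of_nonneg_left (Real.rpow_le_rpow
          (Finset.sum_nonneg fun i _ => Real.rpow_nonneg (hcg i) _) ?_ (by positivity))
          (Real.rpow_nonneg (Finset.sum_nonneg fun i _ => Real.rpow_nonneg (hf i) _) _)
        calc _ ≤ ∑ i, ∑ j, c i j * g j ^ q := Finset.sum_le_sum fun i _ => hJ i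
          _ = ∑ j, (∑ i, c i j) * g j ^ q := by
            rw [Finset.sum_comm]; simp only [Finset.sum_mul]
          _ ≤ _ := Finset.sum_le_sum fun j _ =>
            mul_le_of_le_one_left (Real.rpow_nonneg (hg j) _) (hcol j)

theorem norm_trace_mul_le_schattenNorm_mul {p q : ℝ} (hpq : p.HolderConjugate q)
    (X Y : Matrix m m ℂ) : ‖(X * Y).trace‖ ≤ schattenNorm p X * schattenNorm q Y := by
  obtain ⟨U, V, d, hU, hV, hd, rfl⟩ := exists_singularValueDecomposition X
  obtain ⟨W, Z, e, hW, hZ, he, rfl⟩ := exists_singularValueDecomposition Y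
  rw [schattenNorm_unitary_mul_diagonal_mul hU hV hd,
    schattenNorm_unitary_mul_diagonal_mul hW hZ he]
  have hA : Vᴴ * W ∈ unitaryGroup m ℂ := mul_mem (Unitary.star_mem hV) hW
  have hB : Zᴴ * U ∈ unitaryGroup m ℂ := mul_mem (Unitary.star_mem hZ) hU
  set A := Vᴴ * W with hAdef
  set B := Zᴴ * U with hBdef
  have htr : (U * diagonal (fun i => (d i : ℂ)) * Vᴴ *
      (W * diagonal (fun i => (e i : ℂ)) * Zᴴ)).trace =
      ∑ i, ∑ j, (d i : ℂ) * A i j * e j * B j i := by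
    calc _ = (U * (diagonal (fun i => (d i : ℂ)) * A * diagonal (fun i => (e i : ℂ)) *
          Zᴴ)).trace := by
          simp only [hAdef, Matrix.mul_assoc]
      _ = (diagonal (fun i => (d i : ℂ)) * A * diagonal (fun i => (e i : ℂ)) * B).trace := by
          rw [trace_mul_comm]; simp only [hBdef, Matrix.mul_assoc]
      _ = _ := by
          simp only [trace, diag_apply]
          refine Finset.sum_congr rfl fun i _ => ?_
          rw [mul_apply]
          simp only [mul_diagonal, diagonal_mul]
  have hamgm : ∀ i j, ‖A i j‖ * ‖B j i‖ ≤ (‖A i j‖ ^ 2 + ‖B j i‖ ^ 2) / 2 := fun i j => by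
    linarith [two_mul_le_add_sq ‖A i j‖ ‖B j i‖]
  rw [htr]
  calc _ ≤ ∑ i, ∑ j, d i * (‖A i j‖ * ‖B j i‖) * e j := by
        refine (norm_sum_le _ _).trans (Finset.sum_le_sum fun i _ => (norm_sum_le _ _).trans
          (Finset.sum_le_sum fun j _ => le_of_eq ?_))
        simp only [norm_mul, Complex.norm_real, Real.norm_of_nonneg (hd i),
          Real.norm_of_nonneg (he j)]
        ring
    _ ≤ _ := by
        refine sum_mul_le_Lp_mul_Lq_of_substochastic hpq (fun i j => by positivity)
          (fun i => (Finset.sum_le_sum fun j _ => hamgm i j).trans ?_)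
          (fun j => (Finset.sum_le_sum fun i _ => hamgm i j).trans ?_) hd he
        · rw [← Finset.sum_div, Finset.sum_add_distrib, sum_norm_sq_row_of_mem_unitaryGroup hA,
            sum_norm_sq_col_of_mem_unitaryGroup hB]
          norm_num
        · rw [← Finset.sum_div, Finset.sum_add_distrib, sum_norm_sq_col_of_mem_unitaryGroup hA,
            sum_norm_sq_row_of_mem_unitaryGroup hB]
          norm_num

theorem schattenNorm_nonneg (r : ℝ) (X : Matrix m m ℂ) : 0 ≤ schattenNorm r X :=
  Real.rpow_nonneg (Finset.sum_nonneg fun i _ => Real.rpow_nonneg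
    ((posSemidef_conjTranspose_mul_self X).eigenvalues_nonneg i) _) _

/-- Every matrix has a norming functional for the duality of Schatten norms. -/
theorem exists_trace_mul_eq_schattenNorm_rpow {p q : ℝ} (hpq : p.HolderConjugate q)
    (Y : Matrix m m ℂ) : ∃ X : Matrix m m ℂ,
      (X * Y).trace = ((schattenNorm q Y ^ q : ℝ) : ℂ) ∧
        schattenNorm p X ^ p = schattenNorm q Y ^ q := by
  obtain ⟨U, V, d, hU, hV, hd, rfl⟩ := exists_singularValueDecomposition Y
  have hUU : Uᴴ * U = 1 := mem_unitaryGroup_iff'.mp hU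
  have hVV : Vᴴ * V = 1 := mem_unitaryGroup_iff'.mp hV
  have hd' : ∀ i, 0 ≤ d i ^ (q - 1) := fun i => Real.rpow_nonneg (hd i) _
  have hq : schattenNorm q (U * diagonal (fun i => (d i : ℂ)) * Vᴴ) ^ q = ∑ i, d i ^ q := by
    rw [schattenNorm_unitary_mul_diagonal_mul hU hV hd, one_div, Real.rpow_inv_rpow
      (Finset.sum_nonneg fun i _ => Real.rpow_nonneg (hd i) _) hpq.symm.ne_zero]
  refine ⟨V * diagonal (fun i => ((d i ^ (q - 1) : ℝ) : ℂ)) * Uᴴ, ?_, ?_⟩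
  · rw [hq]
    calc _ = (V * (diagonal (fun i => ((d i ^ (q - 1) : ℝ) : ℂ)) * (Uᴴ * U) *
          diagonal (fun i => (d i : ℂ)) * Vᴴ)).trace := by simp only [Matrix.mul_assoc]
      _ = (diagonal (fun i => ((d i ^ (q - 1) : ℝ) : ℂ)) * diagonal (fun i => (d i : ℂ)) *
          (Vᴴ * V)).trace := by
          rw [trace_mul_comm, hUU, Matrix.mul_one]; simp only [Matrix.mul_assoc]
      _ = _ := by
          rw [hVV, Matrix.mul_one, diagonal_mul_diagonal, trace_diagonal, Complex.ofReal_sum]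
          refine Finset.sum_congr rfl fun i _ => ?_
          rw [← Complex.ofReal_mul]
          congr 1
          rw [← Real.rpow_add_one' (hd i) (by simpa using hpq.symm.ne_zero), sub_add_cancel]
  · rw [hq, schattenNorm_unitary_mul_diagonal_mul hV hU hd', one_div, Real.rpow_inv_rpow
      (Finset.sum_nonneg fun i _ => Real.rpow_nonneg (hd' i) _) hpq.ne_zero]
    refine Finset.sum_congr rfl fun i _ => ?_
    rw [← Real.rpow_mul (hd i), hpq.symm.sub_one_mul_conj]

end Schatten

theorem sum_mul_sum_add_sum_Ioi_sub_mul_sub {R : Type*} [Ring R] {n : ℕ} (x y : Fin n → R) :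
    (∑ i, x i) * (∑ i, y i) + ∑ i, ∑ j ∈ Finset.Ioi i, (x i - x j) * (y i - y j) =
      n * ∑ i, x i * y i := by
  have h1 : ∀ i j, (x i - x j) * (y i - y j) =
      (x j * y j - x j * y i) + (x i * y i - x i * y j) := fun i j => by noncomm_ring
  have h2 := Finset.sum_sum_Ioi_add_eq_sum_sum_off_diag (fun i j => x i * y i - x i * y j)
  simp only [h1]
  rw [h2]
  have h3 : ∀ i, ∑ j ∈ ({i}ᶜ : Finset (Fin n)), (x j * y j - x j * y i) =
      ∑ j, (x j * y j - x j * y i) := fun i =>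
    Finset.sum_subset (Finset.subset_univ _) fun j _ hj => by
      have : j = i := by simpa using hj
      simp [this]
  simp only [h3, Finset.sum_sub_distrib, ← Finset.sum_mul, ← Finset.mul_sum]
  simp

theorem mul_add_sum_le_Lp_mul_Lq {ι : Type*} (s : Finset ι) {p q a b : ℝ} {f g : ι → ℝ}
    (hpq : p.HolderConjugate q) (ha : 0 ≤ a) (hb : 0 ≤ b) (hf : ∀ i, 0 ≤ f i)
    (hg : ∀ i, 0 ≤ g i) :
    a * b + ∑ i ∈ s, f i * g i ≤
      (a ^ p + ∑ i ∈ s, f i ^ p) ^ (1 / p) * (b ^ q + ∑ i ∈ s, g i ^ q) ^ (1 / q) := by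
  have := Real.inner_le_Lp_mul_Lq_of_nonneg (Finset.insertNone s)
    (f := fun o => o.elim a f) (g := fun o => o.elim b g) hpq
    (by rintro (_ | i) _ <;> simp [ha, hf]) (by rintro (_ | i) _ <;> simp [hb, hg])
  simpa using this

theorem ak_duality_transfer {m : Type*} [Fintype m] [DecidableEq m] (n : ℕ)
    (p q : ℝ) (hp1 : 1 < p) (hp2 : p ≤ 2) (hpq : 1 / p + 1 / q = 1)
    (h : ∀ x : Fin n → Matrix m m ℂ,
      schattenNorm p (∑ i, x i) ^ q +
          (∑ i, ∑ j ∈ Finset.Ioi i, schattenNorm p (x i - x j) ^ q) ≤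
        n * (∑ i, schattenNorm p (x i) ^ p) ^ (q / p)) :
    ∀ φ : Fin n → Matrix m m ℂ,
      (n : ℝ) * (∑ i, schattenNorm q (φ i) ^ q) ^ (p / q) ≤
        schattenNorm q (∑ i, φ i) ^ p +
          ∑ i, ∑ j ∈ Finset.Ioi i, schattenNorm q (φ i - φ j) ^ p := by
  intro φ
  have hc : p.HolderConjugate q :=
    Real.holderConjugate_iff.mpr ⟨hp1, by simpa only [one_div] using hpq⟩
  have hp0 := hc.pos
  have hq0 := hc.symm.pos
  choose x hx hxp using fun i => exists_trace_mul_eq_schattenNorm_rpow hc (φ i)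
  set S := ∑ i, schattenNorm q (φ i) ^ q with hS
  set R := schattenNorm q (∑ i, φ i) ^ p +
    ∑ i, ∑ j ∈ Finset.Ioi i, schattenNorm q (φ i - φ j) ^ p
  have hS0 : 0 ≤ S := Finset.sum_nonneg fun i _ => Real.rpow_nonneg (schattenNorm_nonneg _ _) _
  have hR0 : 0 ≤ R := add_nonneg (Real.rpow_nonneg (schattenNorm_nonneg _ _) _)
    (Finset.sum_nonneg fun i _ => Finset.sum_nonneg fun j _ =>
      Real.rpow_nonneg (schattenNorm_nonneg _ _) _)
  have hx' := h x
  simp only [hxp, ← hS] at hx'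
  have hholder : n * S ≤ schattenNorm p (∑ i, x i) * schattenNorm q (∑ i, φ i) +
      ∑ i, ∑ j ∈ Finset.Ioi i, schattenNorm p (x i - x j) * schattenNorm q (φ i - φ j) := by
    have htr := congrArg trace (sum_mul_sum_add_sum_Ioi_sub_mul_sub x φ)
    rw [← nsmul_eq_mul, trace_smul, trace_sum, trace_add, trace_sum] at htr
    simp only [trace_sum, hx, ← Complex.ofReal_sum, ← hS] at htr
    have hn : ‖(n • (S : ℂ))‖ = n * S := by
      rw [nsmul_eq_mul, norm_mul, Complex.norm_natCast, Complex.norm_real, Real.norm_of_nonneg hS0]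
    rw [← hn, ← htr]
    refine (norm_add_le _ _).trans (add_le_add (norm_trace_mul_le_schattenNorm_mul hc _ _) ?_)
    exact (norm_sum_le _ _).trans (Finset.sum_le_sum fun i _ => (norm_sum_le _ _).trans
      (Finset.sum_le_sum fun j _ => norm_trace_mul_le_schattenNorm_mul hc _ _))
  have hbound : n * S ≤ (n * S ^ (q / p)) ^ (1 / q) * R ^ (1 / p) := by
    refine hholder.trans ?_
    have := mul_add_sum_le_Lp_mul_Lq (Finset.univ.sigma fun i : Fin n => Finset.Ioi i)
      (f := fun k => schattenNorm p (x k.1 - x k.2))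
      (g := fun k => schattenNorm q (φ k.1 - φ k.2)) hc.symm
      (schattenNorm_nonneg p (∑ i, x i)) (schattenNorm_nonneg q (∑ i, φ i))
      (fun _ => schattenNorm_nonneg _ _) (fun _ => schattenNorm_nonneg _ _)
    simp only [Finset.sum_sigma] at this
    refine this.trans (mul_le_mul_of_nonneg_right (Real.rpow_le_rpow ?_ hx' (by positivity))
      (Real.rpow_nonneg hR0 _))
    exact add_nonneg (Real.rpow_nonneg (schattenNorm_nonneg _ _) _)
      (Finset.sum_nonneg fun i _ => Finset.sum_nonneg fun j _ =>
        Real.rpow_nonneg (schattenNorm_nonneg _ _) _)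
  have hn0 : (0 : ℝ) ≤ n := n.cast_nonneg
  rcases hn0.eq_or_lt with hn | hn
  · rw [← hn, zero_mul]; exact hR0
  rcases hS0.eq_or_lt with hS' | hS'
  · rw [← hS', Real.zero_rpow (div_pos hp0 hq0).ne', mul_zero]; exact hR0
  have hsplit : (n : ℝ) * S = (n * S ^ (q / p)) ^ (1 / q) * (n * S ^ (p / q)) ^ (1 / p) := by
    rw [Real.mul_rpow hn0 (by positivity), Real.mul_rpow hn0 (by positivity), ← Real.rpow_mul hS0,
      ← Real.rpow_mul hS0, mul_mul_mul_comm, ← Real.rpow_add hn, ← Real.rpow_add hS']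
    have e1 : 1 / q + 1 / p = 1 := by linarith
    have e2 : q / p * (1 / q) + p / q * (1 / p) = 1 := by
      refine Eq.trans ?_ hpq
      field_simp
    rw [e1, e2, Real.rpow_one, Real.rpow_one]
  rw [hsplit] at hbound
  have hle := le_of_mul_le_mul_left hbound (by positivity)
  exact (Real.rpow_le_rpow_iff (by positivity) hR0 (by positivity)).mp hle
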